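/- The number of (2−1)-avoiding inversion sequences of length n equals the number of ascent sequences of length n (both are the n-th Fishburn number). -/

import Mathlib

def ascN (s : List ℕ) : ℕ :=
  ((Finset.range (s.length - 1)).filter fun i => s.getD i 0 < s.getD (i+1) 0).card

def repN (s : List ℕ) : ℕ := s.length - s.dedup.length

def zeroN (s : List ℕ) : ℕ :=
  ((Finset.range s.length).filter fun i => s.getD i 0 = 0).card

def maxN (s : List ℕ) : ℕ :=
  ((Finset.range s.length).filter fun i => s.getD i 0 = i).card

def rminN (s : List ℕ) : ℕ :=
  ((Finset.range s.length).filter fun i =>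
    ∀ j ∈ Finset.range s.length, i < j → s.getD i 0 < s.getD j 0).card

/-- `s` is an inversion sequence: 0-indexed, `s i ≤ i` (i.e. 1-indexed `0 ≤ s_i < i`). -/
def IsInvSeq (s : List ℕ) : Prop := ∀ i < s.length, s.getD i 0 ≤ i

/-- `s` is an ascent sequence. -/
def IsAscSeq (s : List ℕ) : Prop :=
  IsInvSeq s ∧ ∀ i < s.length, s.getD i 0 ≤ ascN (s.take i) + 1

def AscSeqs (n : ℕ) : Set (List ℕ) := {s | IsAscSeq s ∧ s.length = n}

/-- `s` avoids the pattern (2-1): no `i < j` with `s_i = s_j + 1`. -/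
def Avoids21 (s : List ℕ) : Prop :=
  ∀ i j, i < j → j < s.length → s.getD i 0 ≠ s.getD j 0 + 1

section Algebra

variable {R : Type*} [CommRing R]

theorem eq_zero_of_eq_nilpotent_mul_succ {t : R} {N : ℕ} (ht : t ^ N = 0) {β δ : ℕ → R}
    (hβ : ∀ k, t ∣ β k) (hδ : ∀ k, δ k = β k * δ (k + 1)) (k : ℕ) : δ k = 0 := by
  have h : ∀ m k, t ^ m ∣ δ k := by
    intro m
    induction m with
    | zero => simp
    | succ m ih =>
      intro k
      rw [hδ, pow_succ']
      exact mul_dvd_mul (hβ k) (ih _)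
  simpa [ht] using h N k

theorem sum_range_eq_add_of_eq_zero {g : ℕ → R} {N : ℕ} (hg : g N = 0) :
    ∑ n ∈ Finset.range N, g n = g 0 + ∑ n ∈ Finset.range N, g (n + 1) := by
  have h := Finset.sum_range_succ g N
  rw [Finset.sum_range_succ', hg] at h
  linear_combination -h

theorem dvd_one_sub_pow {t x : R} (h : t ∣ 1 - x) (k : ℕ) : t ∣ 1 - x ^ k :=
  h.trans (by simpa using sub_dvd_pow_sub_pow 1 x k)

/-- Truncation of `∑ pⁿ (p^{i+1}; p)_n (p^{j+1}; p)_n`. -/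
def doubleSeries (p : R) (N i j : ℕ) : R :=
  ∑ n ∈ Finset.range N,
    p ^ n * ∏ m ∈ Finset.range n, ((1 - p ^ (i + m + 1)) * (1 - p ^ (j + m + 1)))

theorem doubleSeries_rec {t p : R} {N : ℕ} (ht : t ^ N = 0) (hp : t ∣ 1 - p) (i j : ℕ) :
    doubleSeries p N i j =
      1 + p * (1 - p ^ (i + 1)) * (1 - p ^ (j + 1)) * doubleSeries p N (i + 1) (j + 1) := by
  unfold doubleSeries
  rw [sum_range_eq_add_of_eq_zero]
  · congr 1
    · simp
    · rw [Finset.mul_sum]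
      refine Finset.sum_congr rfl fun n _ => ?_
      rw [Finset.prod_range_succ']
      simp only [add_zero, ← add_assoc, add_right_comm _ _ 1]
      ring
  · have : t ^ N ∣ ∏ m ∈ Finset.range N, ((1 - p ^ (i + m + 1)) * (1 - p ^ (j + m + 1))) := by
      have h := Finset.prod_dvd_prod_of_dvd (s := Finset.range N) (fun _ => t)
        (fun m => (1 - p ^ (i + m + 1)) * (1 - p ^ (j + m + 1)))
        (fun m _ => (dvd_one_sub_pow hp _).mul_right _)
      simpa using h
    rw [ht, zero_dvd_iff] at this
    rw [this, mul_zero]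

theorem doubleSeries_row {t p : R} {N : ℕ} (ht : t ^ N = 0) (hp : t ∣ 1 - p) (i j : ℕ) :
    p ^ (j + 1) * doubleSeries p N i j
      + p ^ (i + 1) * (1 - p ^ (j + 1)) * doubleSeries p N i (j + 1) = 1 := by
  have h := eq_zero_of_eq_nilpotent_mul_succ ht
    (β := fun k => (1 - p ^ (i + k + 1)) * (1 - p ^ (j + k + 1)))
    (δ := fun k => p ^ (j + k + 1) * doubleSeries p N (i + k) (j + k)
      + p ^ (i + k + 1) * (1 - p ^ (j + k + 1)) * doubleSeries p N (i + k) (j + k + 1) - 1)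
    (fun k => (dvd_one_sub_pow hp _).mul_right _) (fun k => ?_) 0
  · simpa [sub_eq_zero] using h
  · rw [doubleSeries_rec ht hp (i + k) (j + k), doubleSeries_rec ht hp (i + k) (j + k + 1)]
    simp only [← add_assoc]
    ring

/-- The diagonal and the row recursion have the same value at the origin. -/
theorem diagonal_eq_row {t p q : R} {N : ℕ} (ht : t ^ N = 0) (hq : q = 1 - t) (hpq : p * q = 1)
    {K d : ℕ → R} (hK : ∀ k, K k = p ^ (k + 1) + (1 - p ^ (k + 1)) ^ 2 * K (k + 1))
    (hd : ∀ k, q * d k = t + (1 - q ^ (k + 1)) * d (k + 1)) : K 0 = 1 + d 0 := by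
  have hp : t ∣ 1 - p := ⟨-p, by subst hq; linear_combination -hpq⟩
  have hqt : t ∣ 1 - q := ⟨1, by rw [hq]; ring⟩
  have h1 := eq_zero_of_eq_nilpotent_mul_succ ht (β := fun k => (1 - p ^ (k + 1)) ^ 2)
    (δ := fun k => K k - p ^ (k + 1) * doubleSeries p N k k)
    (fun k => dvd_pow (dvd_one_sub_pow hp _) two_ne_zero) (fun k => by
      rw [hK, doubleSeries_rec ht hp]
      ring) 0
  have h2 := eq_zero_of_eq_nilpotent_mul_succ ht (β := fun k => p * (1 - q ^ (k + 1)))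
    (δ := fun k => doubleSeries p N 0 k - q * (1 + d k))
    (fun k => (dvd_one_sub_pow hqt _).mul_left _) (fun k => by
      have h := doubleSeries_row ht hp 0 k
      have hpk : p ^ (k + 1) * q ^ (k + 1) = 1 := by rw [← mul_pow, hpq, one_pow]
      simp only [zero_add, pow_one] at h ⊢
      linear_combination q ^ (k + 1) * h - hd k
        + (p * doubleSeries p N 0 (k + 1) - doubleSeries p N 0 k) * hpk
        + (1 - q ^ (k + 1)) * (1 + d (k + 1)) * hpq - hq) 0
  simp only [zero_add, pow_one] at h1 h2
  linear_combination h1 + p * h2 + (1 + d 0) * hpq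

end Algebra

section Ascent

/-- The last entry of a list, with value `0` on the empty list. -/
def lastN (s : List ℕ) : ℕ := s.getD (s.length - 1) 0

theorem ascN_append_singleton {s : List ℕ} (hs : s ≠ []) (x : ℕ) :
    ascN (s ++ [x]) = ascN s + if lastN s < x then 1 else 0 := by
  obtain ⟨m, hm⟩ : ∃ m, s.length = m + 1 :=
    Nat.exists_eq_succ_of_ne_zero (by simpa using hs)
  unfold ascN lastN
  simp only [List.length_append, List.length_singleton, hm, Nat.add_sub_cancel]
  rw [Finset.range_add_one, Finset.filter_insert]
  have h1 : (Finset.range m).filter (fun i => (s ++ [x]).getD i 0 < (s ++ [x]).getD (i + 1) 0)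
      = (Finset.range m).filter (fun i => s.getD i 0 < s.getD (i + 1) 0) := by
    refine Finset.filter_congr fun i hi => ?_
    rw [Finset.mem_range] at hi
    rw [List.getD_append _ _ _ _ (by omega), List.getD_append _ _ _ _ (by omega)]
  rw [h1, List.getD_append _ _ _ _ (by omega), List.getD_append_right _ _ _ _ (by omega)]
  simp only [hm, Nat.sub_self, List.getD_cons_zero]
  split_ifs
  · rw [Finset.card_insert_of_notMem (by simp)]
  · rfl

theorem lastN_append_singleton (s : List ℕ) (x : ℕ) : lastN (s ++ [x]) = x := by
  simp [lastN]

/-- The ascent sequences of length `n + 1`. -/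
def ascFinset : ℕ → Finset (List ℕ)
  | 0 => {[0]}
  | n + 1 => ((ascFinset n).sigma fun s => Finset.range (ascN s + 2)).image
      fun p => p.1 ++ [p.2]

theorem isAscSeq_append_singleton {s : List ℕ} (hs : s ≠ []) (x : ℕ) :
    IsAscSeq (s ++ [x]) ↔ IsAscSeq s ∧ x ≤ ascN s + 1 := by
  have hasc : ascN s + 1 ≤ s.length := by
    have h : ascN s ≤ s.length - 1 := by
      simpa [ascN] using Finset.card_filter_le (Finset.range (s.length - 1))
        (fun i => s.getD i 0 < s.getD (i + 1) 0)
    have := List.length_pos_of_ne_nil hs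
    omega
  have key : ∀ i < s.length, (s ++ [x]).getD i 0 = s.getD i 0 :=
    fun i hi => List.getD_append _ _ _ _ hi
  have keyx : (s ++ [x]).getD s.length 0 = x := by simp
  have keyt : ∀ i ≤ s.length, (s ++ [x]).take i = s.take i :=
    fun i hi => List.take_append_of_le_length hi
  unfold IsAscSeq IsInvSeq
  simp only [List.length_append, List.length_singleton, Nat.forall_lt_succ_right, keyx,
    keyt _ le_rfl, List.take_length]
  constructor
  · rintro ⟨⟨h1, -⟩, h2, h3⟩
    exact ⟨⟨fun i hi => key i hi ▸ h1 i hi,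
      fun i hi => key i hi ▸ keyt i hi.le ▸ h2 i hi⟩, h3⟩
  · rintro ⟨⟨h1, h2⟩, h3⟩
    exact ⟨⟨fun i hi => (key i hi).symm ▸ h1 i hi, by omega⟩,
      fun i hi => by rw [key i hi, keyt i hi.le]; exact h2 i hi, h3⟩

theorem mem_ascFinset {n : ℕ} {s : List ℕ} : s ∈ ascFinset n ↔ s ∈ AscSeqs (n + 1) := by
  unfold AscSeqs
  induction n generalizing s with
  | zero =>
    simp only [ascFinset, Finset.mem_singleton, Set.mem_ofPred_eq]
    constructor
    · rintro rfl
      simp [IsAscSeq, IsInvSeq]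
    · rintro ⟨⟨h, -⟩, hl⟩
      obtain ⟨a, rfl⟩ := List.length_eq_one_iff.1 hl
      simpa using h 0 (by simp)
  | succ n ih =>
    simp only [ascFinset, Finset.mem_image, Finset.mem_sigma, Finset.mem_range, Set.mem_ofPred_eq]
    constructor
    · rintro ⟨⟨s, x⟩, ⟨hs, hx⟩, rfl⟩
      obtain ⟨ha, hl⟩ := ih.1 hs
      have hne : s ≠ [] := by rintro rfl; simp at hl
      exact ⟨(isAscSeq_append_singleton hne x).2 ⟨ha, by simpa [Nat.lt_succ_iff] using hx⟩,
        by simp [hl]⟩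
    · rintro ⟨ha, hl⟩
      rcases List.eq_nil_or_concat' s with rfl | ⟨s, x, rfl⟩
      · simp at hl
      · have hl' : s.length = n + 1 := by simpa using hl
        have hne : s ≠ [] := by rintro rfl; simp at hl'
        obtain ⟨h1, h2⟩ := (isAscSeq_append_singleton hne x).1 ha
        exact ⟨⟨s, x⟩, ⟨ih.2 ⟨h1, hl'⟩, by simpa [Nat.lt_succ_iff] using h2⟩, rfl⟩

theorem ne_nil_of_mem_ascFinset {n : ℕ} {s : List ℕ} (hs : s ∈ ascFinset n) : s ≠ [] := by
  rintro rfl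
  simpa using (mem_ascFinset.1 hs).2

theorem lastN_le_ascN {n : ℕ} {s : List ℕ} (hs : s ∈ ascFinset n) : lastN s ≤ ascN s := by
  induction n generalizing s with
  | zero =>
    rw [ascFinset, Finset.mem_singleton] at hs
    subst hs
    simp [lastN]
  | succ n ih =>
    simp only [ascFinset, Finset.mem_image, Finset.mem_sigma, Finset.mem_range] at hs
    obtain ⟨⟨s, x⟩, ⟨hs, hx⟩, rfl⟩ := hs
    have hl : lastN s ≤ ascN s := ih hs
    have hx' : x < ascN s + 2 := hx
    change lastN (s ++ [x]) ≤ ascN (s ++ [x])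
    rw [lastN_append_singleton, ascN_append_singleton (s := s) (ne_nil_of_mem_ascFinset hs) x]
    split_ifs <;> omega

theorem sum_ascFinset_succ {A : Type*} [AddCommMonoid A] (n : ℕ) (f : List ℕ → A) :
    ∑ s ∈ ascFinset (n + 1), f s =
      ∑ s ∈ ascFinset n, ∑ x ∈ Finset.range (ascN s + 2), f (s ++ [x]) := by
  rw [ascFinset, Finset.sum_image, Finset.sum_sigma]
  rintro ⟨s, x⟩ - ⟨s', x'⟩ - h
  obtain ⟨rfl, h⟩ := List.append_inj' h rfl
  simpa using h

variable {A : Type*} [CommRing A]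

/-- The kernel of the functional equation for ascent sequences: the weight `z u^{asc + 1} v^{last}`
is turned by one insertion step into weights that depend on the number of ascents only. -/
theorem kernel_step {t q z u v J : A} (hq : q = 1 - t) (hu : u * (1 - z) = 1)
    (hJ : J * (1 - q * z) = 1) (hv : v = (1 - z) * J) {a l : ℕ} (hl : l ≤ a) :
    t * ∑ x ∈ Finset.range (a + 2), z * u ^ (a + (if l < x then 1 else 0) + 1) * v ^ x =
      z * u ^ (a + 1) * v ^ l + (1 - q * z) * u ^ (a + 1) - J ^ (a + 1) := by
  obtain ⟨m, rfl⟩ := Nat.exists_eq_add_of_le hl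
  have huv : u * v = J := by rw [hv]; linear_combination J * hu
  have h1v : 1 - v = t * z * J := by
    rw [hv]; subst hq; linear_combination -hJ
  have hsum (k : ℕ) : t * z * ∑ x ∈ Finset.range k, v ^ x = (1 - q * z) * (1 - v ^ k) := by
    rw [← mul_neg_geom_sum, h1v]
    linear_combination (-(t * z * ∑ x ∈ Finset.range k, v ^ x)) * hJ
  have h1 : ∑ x ∈ Finset.range (l + 1),
      z * u ^ (l + m + (if l < x then 1 else 0) + 1) * v ^ x =
      z * u ^ (l + m + 1) * ∑ x ∈ Finset.range (l + 1), v ^ x := by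
    rw [Finset.mul_sum]
    refine Finset.sum_congr rfl fun x hx => ?_
    rw [if_neg (by rw [Finset.mem_range] at hx; omega), add_zero]
  have h2 : ∑ x ∈ Finset.range (m + 1),
      z * u ^ (l + m + (if l < l + 1 + x then 1 else 0) + 1) * v ^ (l + 1 + x) =
      z * u ^ (l + m + 2) * v ^ (l + 1) * ∑ x ∈ Finset.range (m + 1), v ^ x := by
    rw [Finset.mul_sum]
    refine Finset.sum_congr rfl fun x _ => ?_
    rw [if_pos (by omega)]
    ring
  have hJ' : u ^ (l + m + 2) * v ^ (l + m + 2) = J ^ (l + m + 2) := by rw [← mul_pow, huv]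
  have hvJ : (1 - q * z) * v = 1 - z := by rw [hv]; linear_combination (1 - z) * hJ
  rw [show l + m + 2 = l + 1 + (m + 1) by ring, Finset.sum_range_add, h1, h2]
  have e1 := hsum (l + 1)
  have e2 := hsum (m + 1)
  linear_combination u ^ (l + m + 1) * e1 + u ^ (l + m + 2) * v ^ (l + 1) * e2
    + (u - 1) * u ^ (l + m + 1) * v ^ l * hvJ + u ^ (l + m + 1) * v ^ l * hu
    - (1 - q * z) * hJ' - J ^ (l + m + 1) * hJ

end Ascent
section AscentSeries

open PowerSeries

variable {R : Type*} [CommRing R]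

theorem kernel_sum {t q z u v J : R} (hq : q = 1 - t) (hu : u * (1 - z) = 1)
    (hJ : J * (1 - q * z) = 1) (hv : v = (1 - z) * J) {N : ℕ} (ht : t ^ N = 0) :
    (1 - q * z) * ∑ n ∈ Finset.range N, t ^ (n + 1) * ∑ s ∈ ascFinset n, u ^ (ascN s + 1) =
      ∑ n ∈ Finset.range N, t ^ (n + 1) * ∑ s ∈ ascFinset n, J ^ (ascN s + 1) - t * z * u := by
  have hstep (n : ℕ) : t * ∑ s ∈ ascFinset (n + 1), z * u ^ (ascN s + 1) * v ^ lastN s =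
      ∑ s ∈ ascFinset n, z * u ^ (ascN s + 1) * v ^ lastN s
        + (1 - q * z) * ∑ s ∈ ascFinset n, u ^ (ascN s + 1)
        - ∑ s ∈ ascFinset n, J ^ (ascN s + 1) := by
    rw [sum_ascFinset_succ, Finset.mul_sum, Finset.mul_sum, ← Finset.sum_add_distrib,
      ← Finset.sum_sub_distrib]
    refine Finset.sum_congr rfl fun s hs => ?_
    rw [← kernel_step hq hu hJ hv (lastN_le_ascN hs)]
    simp only [lastN_append_singleton, ascN_append_singleton (ne_nil_of_mem_ascFinset hs)]
  have h := sum_range_eq_add_of_eq_zero (N := N)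
    (g := fun n => t ^ (n + 1) * ∑ s ∈ ascFinset n, z * u ^ (ascN s + 1) * v ^ lastN s)
    (by simp [pow_succ, ht])
  have h0 : ∑ s ∈ ascFinset 0, z * u ^ (ascN s + 1) * v ^ lastN s = z * u := by
    simp [ascFinset, ascN, lastN]
  simp only [pow_succ t (_ + 1), mul_assoc _ t, hstep, mul_sub, mul_add, Finset.sum_add_distrib,
    Finset.sum_sub_distrib, h0] at h
  simp only [mul_left_comm _ (1 - q * z), ← Finset.mul_sum] at h
  linear_combination -h

theorem ascFinset_series_rec {t q : R} (hq : q = 1 - t) {N : ℕ} (ht : t ^ N = 0) (k : ℕ) :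
    q * ∑ n ∈ Finset.range N, t ^ (n + 1) * ∑ s ∈ ascFinset n, ((ascN s + k).choose (ascN s) : R) =
      t + (1 - q ^ (k + 1)) * ∑ n ∈ Finset.range N,
        t ^ (n + 1) * ∑ s ∈ ascFinset n, ((ascN s + (k + 1)).choose (ascN s) : R) := by
  have hu : (mk 1 : R⟦X⟧) * (1 - X) = 1 := mk_one_mul_one_sub_eq_one R
  have hJ : rescale q (mk 1 : R⟦X⟧) * (1 - C q * X) = 1 := by
    simpa [rescale_X] using congrArg (rescale q) hu
  have h := kernel_sum (t := C t) (q := C q) (by simp [hq]) hu hJ rfl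
    (show (C t : R⟦X⟧) ^ N = 0 by rw [← map_pow, ht, map_zero])
  simp only [← map_pow] at h
  have h1 (m : ℕ) : ∑ n ∈ Finset.range N, t ^ (n + 1) * ∑ s ∈ ascFinset n,
      ((ascN s + m).choose (ascN s) : R) = coeff m (∑ n ∈ Finset.range N,
        C (t ^ (n + 1)) * ∑ s ∈ ascFinset n, (mk 1 : R⟦X⟧) ^ (ascN s + 1)) := by
    simp only [map_sum, coeff_C_mul, mk_one_pow_eq_mk_choose_add, coeff_mk]
  have h2 (m : ℕ) : q ^ m * coeff m (∑ n ∈ Finset.range N,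
      C (t ^ (n + 1)) * ∑ s ∈ ascFinset n, (mk 1 : R⟦X⟧) ^ (ascN s + 1)) =
      coeff m (∑ n ∈ Finset.range N,
        C (t ^ (n + 1)) * ∑ s ∈ ascFinset n, rescale q ((mk 1 : R⟦X⟧) ^ (ascN s + 1))) := by
    simp only [map_sum, coeff_C_mul, coeff_rescale, Finset.mul_sum]
    simp only [mul_left_comm]
  have hk := congrArg (coeff (k + 1)) h
  simp only [sub_mul, one_mul, map_sub, mul_assoc, coeff_C_mul, coeff_succ_X_mul, coeff_mk,
    Pi.one_apply, mul_one] at hk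
  rw [h1, h1]
  linear_combination h2 (k + 1) - hk

end AscentSeries

section Words

/-- Turns some of the zeros (unassigned entries) of a word into ones after increasing all its
nonzero entries, in such a way that no `1` appears after a `2`. -/
def fills : List ℕ → Finset (List ℕ)
  | [] => {[]}
  | 0 :: r => (fills r).image (List.cons 0) ∪ (fills r).image (List.cons 1)
  | 1 :: r => {2 :: r.map fun c => if c = 0 then 0 else c + 1}
  | (c + 2) :: r => (fills r).image (List.cons (c + 3))

/-- Words of length `n` with entries `w i ≤ i + 1`, where `0` stands for an unassigned entry,
whose nonzero entries avoid the pattern (2-1). -/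
def words : ℕ → Finset (List ℕ)
  | 0 => {[]}
  | n + 1 => (words n).biUnion fun w => fills (0 :: w)

theorem eq_map_shift_iff {t r : List ℕ} :
    t = r.map (fun c => if c = 0 then 0 else c + 1) ↔ t.map Nat.pred = r ∧ 1 ∉ t := by
  induction r generalizing t with
  | nil => cases t <;> simp
  | cons c r ih =>
    cases t with
    | nil => simp
    | cons h t =>
      simp only [List.map_cons, List.cons.injEq, ih, List.mem_cons, not_or, Nat.pred_eq_sub_one]
      have : (h = if c = 0 then 0 else c + 1) ↔ h - 1 = c ∧ 1 ≠ h := by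
        split_ifs <;> omega
      rw [this]
      tauto

theorem mem_fills {l w : List ℕ} :
    w ∈ fills l ↔ w.map Nat.pred = l ∧ w.Pairwise fun a b => ¬(a = 2 ∧ b = 1) := by
  induction l generalizing w with
  | nil =>
    simp only [fills, Finset.mem_singleton, List.map_eq_nil_iff]
    constructor
    · rintro rfl
      simp
    · exact fun h => h.1
  | cons c r ih =>
    cases w with
    | nil => rcases c with _ | _ | c <;> simp [fills]
    | cons h t =>
      rcases c with _ | _ | c
      · simp only [fills, Finset.mem_union, Finset.mem_image, List.cons.injEq, ih,
          List.map_cons, List.pairwise_cons, Nat.pred_eq_sub_one]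
        constructor
        · rintro (⟨s, hs, rfl, rfl⟩ | ⟨s, hs, rfl, rfl⟩)
          all_goals exact ⟨⟨rfl, hs.1⟩, by simp, hs.2⟩
        · rintro ⟨⟨h0, h1⟩, -, h2⟩
          obtain rfl | rfl : h = 0 ∨ h = 1 := by omega
          · exact Or.inl ⟨t, ⟨h1, h2⟩, rfl, rfl⟩
          · exact Or.inr ⟨t, ⟨h1, h2⟩, rfl, rfl⟩
      · simp only [fills, Finset.mem_singleton, List.cons.injEq, zero_add, eq_map_shift_iff,
          List.map_cons, List.pairwise_cons, Nat.pred_eq_sub_one]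
        constructor
        · rintro ⟨rfl, h1, h2⟩
          refine ⟨⟨rfl, h1⟩, fun b hb h => h2 (h.2 ▸ hb), ?_⟩
          exact List.pairwise_of_forall_mem_list fun a _ b hb h => h2 (h.2 ▸ hb)
        · rintro ⟨⟨h0, h1⟩, h2, -⟩
          obtain rfl : h = 2 := by omega
          exact ⟨rfl, h1, fun h => h2 1 h ⟨rfl, rfl⟩⟩
      · simp only [fills, Finset.mem_image, List.cons.injEq, ih,
          List.map_cons, List.pairwise_cons, Nat.pred_eq_sub_one]
        constructor
        · rintro ⟨s, hs, rfl, rfl⟩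
          exact ⟨⟨rfl, hs.1⟩, by simp, hs.2⟩
        · rintro ⟨⟨h0, h1⟩, -, h2⟩
          exact ⟨t, ⟨h1, h2⟩, by omega, rfl⟩

theorem mem_words {n : ℕ} {w : List ℕ} :
    w ∈ words n ↔ w.length = n ∧ (∀ i < w.length, w.getD i 0 ≤ i + 1) ∧
      w.Pairwise fun a b => b ≠ 0 → a ≠ b + 1 := by
  induction n generalizing w with
  | zero =>
    simp only [words, Finset.mem_singleton, List.length_eq_zero_iff]
    constructor
    · rintro rfl
      simp
    · exact fun h => h.1
  | succ n ih =>
    cases w with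
    | nil => simp [words, mem_fills]
    | cons h t =>
      have hpair : (h :: t).Pairwise (fun a b => b ≠ 0 → a ≠ b + 1) ↔
          (h :: t).Pairwise (fun a b => ¬(a = 2 ∧ b = 1)) ∧
          ((h :: t).map Nat.pred).Pairwise (fun a b => b ≠ 0 → a ≠ b + 1) := by
        rw [List.pairwise_map, ← List.pairwise_and_iff]
        refine iff_of_eq (congrArg (fun P => (h :: t).Pairwise P) ?_)
        ext a b
        simp only [Nat.pred_eq_sub_one]
        omega
      have hbound : (∀ i < (h :: t).length, (h :: t).getD i 0 ≤ i + 1) ↔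
          h ≤ 1 ∧ ∀ i < t.length, (t.map Nat.pred).getD i 0 ≤ i + 1 := by
        rw [List.length_cons, Nat.forall_lt_succ_left]
        simp only [List.getD_cons_zero, zero_add, List.getD_cons_succ]
        refine and_congr_right fun _ => forall₂_congr fun i hi => ?_
        rw [← Nat.pred_zero, List.getD_map, Nat.pred_zero, Nat.pred_eq_sub_one]
        omega
      simp only [words, Finset.mem_biUnion, mem_fills, List.map_cons, List.cons.injEq, ih]
      rw [hpair, hbound]
      simp only [List.map_cons, List.pairwise_cons, List.length_cons, Nat.pred_eq_sub_one]
      constructor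
      · rintro ⟨_, ⟨h1, h2, h3⟩, ⟨h4, rfl⟩, h5⟩
        rw [List.length_map] at h1 h2
        exact ⟨by omega, ⟨by omega, h2⟩, h5, fun b _ _ => by omega, h3⟩
      · rintro ⟨h1, ⟨h2, h3⟩, h4, -, h5⟩
        exact ⟨_, ⟨by rw [List.length_map]; omega, by rwa [List.length_map], h5⟩,
          ⟨by omega, rfl⟩, h4⟩

theorem sum_words_succ {A : Type*} [AddCommMonoid A] (n : ℕ) (f : List ℕ → A) :
    ∑ w ∈ words (n + 1), f w = ∑ w ∈ words n, ∑ w' ∈ fills (0 :: w), f w' := by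
  rw [words, Finset.sum_biUnion]
  intro v _ w _ hvw
  refine Finset.disjoint_left.2 fun s hs hs' => hvw ?_
  simpa using (mem_fills.1 hs).1.symm.trans (mem_fills.1 hs').1

variable {R : Type*} [CommRing R]

/-- Unassigned entries have weight `y` before the first `1` and `x` after it. -/
def poolWeight : R → R → List ℕ → R
  | _, _, [] => 1
  | x, y, 0 :: r => y * poolWeight x y r
  | x, _, 1 :: r => poolWeight x x r
  | x, y, (_ + 2) :: r => poolWeight x y r

theorem poolWeight_map_shift (x y : R) (r : List ℕ) :
    poolWeight x y (r.map fun c => if c = 0 then 0 else c + 1) = poolWeight y y r := by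
  induction r with
  | nil => simp [poolWeight]
  | cons c r ih => rcases c with _ | _ | c <;> simp_all [poolWeight]

theorem sum_fills_zero_cons (r : List ℕ) (f : List ℕ → R) :
    ∑ w ∈ fills (0 :: r), f w = ∑ w ∈ fills r, f (0 :: w) + ∑ w ∈ fills r, f (1 :: w) := by
  rw [fills, Finset.sum_union, Finset.sum_image (by simp), Finset.sum_image (by simp)]
  refine Finset.disjoint_left.2 fun s hs hs' => ?_
  rw [Finset.mem_image] at hs hs'
  obtain ⟨_, -, rfl⟩ := hs
  obtain ⟨_, -, h⟩ := hs'
  simp at h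

theorem sum_fills_diag (x : R) (r : List ℕ) :
    ∑ w ∈ fills r, poolWeight x x w = poolWeight x (1 + x) r := by
  induction r with
  | nil => simp [fills, poolWeight]
  | cons c r ih =>
    rcases c with _ | _ | c
    · rw [sum_fills_zero_cons]
      simp only [poolWeight, ← Finset.mul_sum, ih]
      ring
    · simp [fills, poolWeight, poolWeight_map_shift]
    · rw [fills, Finset.sum_image (by simp)]
      simpa [poolWeight] using ih

theorem sum_fills (x y : R) (r : List ℕ) :
    (1 + x - y) * (∑ w ∈ fills r, poolWeight x y w - poolWeight y y r) =
      poolWeight x (1 + x) r - poolWeight x y r := by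
  induction r with
  | nil => simp [fills, poolWeight]
  | cons c r ih =>
    rcases c with _ | _ | c
    · rw [sum_fills_zero_cons]
      simp only [poolWeight, ← Finset.mul_sum, sum_fills_diag]
      linear_combination y * ih
    · simp [fills, poolWeight, poolWeight_map_shift]
    · rw [fills, Finset.sum_image (by simp)]
      simpa [poolWeight] using ih

/-- Truncated generating function of words by length and unassigned entries. -/
def wordSeries (t : R) (N : ℕ) (x y : R) : R :=
  ∑ n ∈ Finset.range N, t ^ n * ∑ w ∈ words n, poolWeight x y w

theorem wordSeries_functional_eq {t : R} {N : ℕ} (ht : t ^ N = 0) (x y : R) :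
    (1 + x - y) * (wordSeries t N x y - 1 - t * y * wordSeries t N y y) =
      t * ((1 + x) * wordSeries t N x (1 + x) - y * wordSeries t N x y) := by
  have h := sum_range_eq_add_of_eq_zero (N := N)
    (g := fun n => t ^ n * ∑ w ∈ words n, poolWeight x y w) (by simp [ht])
  have hstep (n : ℕ) : (1 + x - y) * (∑ w ∈ words (n + 1), poolWeight x y w
      - y * ∑ w ∈ words n, poolWeight y y w) =
      (1 + x) * ∑ w ∈ words n, poolWeight x (1 + x) w - y * ∑ w ∈ words n, poolWeight x y w := by
    simp only [sum_words_succ, Finset.mul_sum, ← Finset.sum_sub_distrib]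
    refine Finset.sum_congr rfl fun w _ => ?_
    simpa [poolWeight] using sum_fills x y (0 :: w)
  have h0 : ∑ w ∈ words 0, poolWeight x y w = 1 := by simp [words, poolWeight]
  have h1 : wordSeries t N x y - 1 - t * y * wordSeries t N y y =
      ∑ n ∈ Finset.range N, t ^ (n + 1) * (∑ w ∈ words (n + 1), poolWeight x y w
        - y * ∑ w ∈ words n, poolWeight y y w) := by
    unfold wordSeries
    rw [h, h0, pow_zero, one_mul, add_sub_cancel_left, Finset.mul_sum, ← Finset.sum_sub_distrib]
    refine Finset.sum_congr rfl fun n _ => ?_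
    ring
  rw [h1, Finset.mul_sum]
  simp only [wordSeries, Finset.mul_sum (Finset.range N), ← Finset.sum_sub_distrib]
  refine Finset.sum_congr rfl fun n _ => ?_
  linear_combination t ^ (n + 1) * hstep n

theorem wordSeries_diag {t q : R} (hq : q = 1 - t) {N : ℕ} (ht : t ^ N = 0) {x y : R}
    (hy : q * y = 1 + x) :
    wordSeries t N x x = 1 + t * y + (t * y) ^ 2 * wordSeries t N y y := by
  subst hq
  have h1 := wordSeries_functional_eq ht x x
  have h2 := wordSeries_functional_eq ht x y
  linear_combination h1 - h2 - (wordSeries t N x y - 1 - t * y * wordSeries t N y y) * hy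

theorem wordSeries_zero_eq {t p q : R} (hq : q = 1 - t) (hpq : p * q = 1) {N : ℕ}
    (ht : t ^ N = 0) :
    wordSeries t N 0 0 = 1 + ∑ n ∈ Finset.range N, t ^ (n + 1) * ((ascFinset n).card : R) := by
  have hx (k : ℕ) : t * (fun x => p * (1 + x))^[k] 0 = p ^ k - 1 := by
    induction k with
    | zero => simp
    | succ k ih =>
      rw [Function.iterate_succ_apply']
      subst hq
      linear_combination p * ih - hpq
  have h := diagonal_eq_row ht hq hpq
    (K := fun k => wordSeries t N ((fun x => p * (1 + x))^[k] 0) ((fun x => p * (1 + x))^[k] 0))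
    (d := fun k => ∑ n ∈ Finset.range N,
      t ^ (n + 1) * ∑ s ∈ ascFinset n, ((ascN s + k).choose (ascN s) : R))
    (fun k => ?_) (ascFinset_series_rec hq ht)
  · simpa using h
  · rw [wordSeries_diag hq ht (y := (fun x => p * (1 + x))^[k + 1] 0), hx]
    · ring
    · rw [Function.iterate_succ_apply']
      linear_combination (1 + (fun x => p * (1 + x))^[k] 0) * hpq

theorem poolWeight_zero_zero (w : List ℕ) :
    poolWeight (0 : R) 0 w = if 0 ∈ w then 0 else 1 := by
  induction w with
  | nil => simp [poolWeight]
  | cons c r ih => rcases c with _ | _ | c <;> simp [poolWeight, ih]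

end Words

theorem avoids21_iff_pairwise {s : List ℕ} : Avoids21 s ↔ s.Pairwise fun a b => a ≠ b + 1 := by
  rw [List.pairwise_iff_getElem]
  constructor
  · intro h i j hi hj hij
    simpa [List.getD_eq_getElem, hi, hj] using h i j hij hj
  · intro h i j hij hj
    simpa [List.getD_eq_getElem, hij.trans hj, hj] using h i j (hij.trans hj) hj hij

theorem ncard_avoiding (n : ℕ) :
    {s : List ℕ | IsInvSeq s ∧ Avoids21 s ∧ s.length = n}.ncard =
      ((words n).filter fun w => 0 ∉ w).card := by
  have hinj : Function.Injective (List.map Nat.succ) := List.map_injective_iff.2 Nat.succ_injective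
  rw [← Set.ncard_coe_finset, ← Set.ncard_image_of_injective _ hinj]
  congr 1
  have key (s : List ℕ) : (IsInvSeq s ∧ Avoids21 s ∧ s.length = n) ↔
      s.map Nat.succ ∈ words n := by
    rw [mem_words, avoids21_iff_pairwise, List.pairwise_map, List.length_map, IsInvSeq]
    have h1 : (∀ i < s.length, (s.map Nat.succ).getD i 0 ≤ i + 1) ↔
        ∀ i < s.length, s.getD i 0 ≤ i := by
      refine forall₂_congr fun i hi => ?_
      simp [hi]
    simp only [h1, Nat.succ_eq_add_one, ne_eq, Nat.add_eq_zero_iff, one_ne_zero, and_false,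
      not_false_eq_true, forall_const, Nat.add_right_cancel_iff]
    tauto
  ext w
  simp only [Set.mem_image, Set.mem_ofPred_eq, key, Finset.coe_filter]
  constructor
  · rintro ⟨s, hs, rfl⟩
    exact ⟨hs, by simp⟩
  · rintro ⟨hw, h0⟩
    have : (w.map Nat.pred).map Nat.succ = w := by
      rw [List.map_map]
      refine (List.map_congr_left fun c hc => ?_).trans (List.map_id w)
      exact Nat.succ_pred (ne_of_mem_of_not_mem hc h0)
    exact ⟨w.map Nat.pred, by rwa [this], this⟩

open Polynomial in
/-- Sequences are equal if their generating functions agree modulo every power of the variable. -/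
theorem eq_of_sum_range_eq {a b : ℕ → ℕ}
    (h : ∀ (R : Type) [CommRing R] (t : R) (N : ℕ), t ^ N = 0 →
      ∑ n ∈ Finset.range N, t ^ n * (a n : R) = ∑ n ∈ Finset.range N, t ^ n * (b n : R)) (n : ℕ) :
    a n = b n := by
  have h1 := h (ℤ[X] ⧸ Ideal.span {(X : ℤ[X]) ^ (n + 1)}) (Ideal.Quotient.mk _ X) (n + 1)
    (by rw [← map_pow, Ideal.Quotient.eq_zero_iff_mem]; exact Ideal.mem_span_singleton_self _)
  have h2 : Ideal.Quotient.mk (Ideal.span {(X : ℤ[X]) ^ (n + 1)})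
      (∑ m ∈ Finset.range (n + 1), X ^ m * (a m : ℤ[X])) = Ideal.Quotient.mk _
      (∑ m ∈ Finset.range (n + 1), X ^ m * (b m : ℤ[X])) := by
    simpa using h1
  rw [Ideal.Quotient.eq, Ideal.mem_span_singleton, X_pow_dvd_iff] at h2
  have h3 := h2 n n.lt_succ_self
  have hc (c : ℕ → ℕ) : (∑ m ∈ Finset.range (n + 1), X ^ m * (c m : ℤ[X])).coeff n = (c n : ℤ) := by
    simp [finsetSum_coeff, coeff_mul_natCast, coeff_X_pow]
  rw [coeff_sub, hc, hc] at h3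
  exact_mod_cast sub_eq_zero.1 h3

theorem ncard_ascSeqs_succ (n : ℕ) : (AscSeqs (n + 1)).ncard = (ascFinset n).card := by
  rw [← Set.ncard_coe_finset]
  congr 1
  ext s
  simp [mem_ascFinset]

theorem ncard_ascSeqs_zero : (AscSeqs 0).ncard = 1 := by
  rw [Set.ncard_eq_one]
  refine ⟨[], Set.ext fun s => ?_⟩
  simp only [AscSeqs, Set.mem_ofPred_eq, List.length_eq_zero_iff, Set.mem_singleton_iff]
  constructor
  · exact fun h => h.2
  · rintro rfl
    simp [IsAscSeq, IsInvSeq]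

/-- (2-1)-avoiding inversion sequences of length `n` are equinumerous with
ascent sequences of length `n`. -/
theorem avoiding_card_eq_ascent_card (n : ℕ) :
    {s : List ℕ | IsInvSeq s ∧ Avoids21 s ∧ s.length = n}.ncard =
    (AscSeqs n).ncard := by
  refine eq_of_sum_range_eq
    (a := fun n => {s : List ℕ | IsInvSeq s ∧ Avoids21 s ∧ s.length = n}.ncard)
    (b := fun n => (AscSeqs n).ncard)
    (fun R _ t N ht => ?_) n
  obtain ⟨p, hp⟩ : ∃ p : R, p * (1 - t) = 1 :=
    (IsNilpotent.isUnit_one_sub ⟨N, ht⟩).exists_left_inv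
  have h := wordSeries_zero_eq rfl hp ht
  simp only [wordSeries, poolWeight_zero_zero] at h
  rw [sum_range_eq_add_of_eq_zero (g := fun n => t ^ n * ((AscSeqs n).ncard : R)) (by simp [ht])]
  simp only [ncard_ascSeqs_succ, ncard_ascSeqs_zero, ncard_avoiding]
  simpa [Finset.sum_ite] using h
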